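/- Rational solutions of the odd-periodic dressing chains from cyclic Maya diagrams: let ω > 0, p ≥ 1, k ≥ 1, let M₀ be a finite set of positive integers, and let ν₁, …, ν_p be nonnegative integers; define M_i = M_{i−1} Δ {ν_i} for i = 1, …, p, and assume the cyclicity condition M_p = {0, 1, …, k−1} ∪ {n + k : n ∈ M₀}. For a finite set S of naturals, let H^S(z) denote the Wronskian of the Hermite polynomials H_n with n ∈ S taken in increasing order (H^∅ = 1). With z = √(ω/2)·x, define for i = 1, …, p the functions w_i(x) = σ_i·ωx/2 + √(ω/2)·(d/dz)[log(H^{M_{i−1}}(z)/H^{M_i}(z))], where σ_i = −1 if ν_i ∈ M_{i−1} (positive flip) and σ_i = +1 if ν_i ∉ M_{i−1} (negative flip). Then at every x such that H^{M_i}(√(ω/2)·x) ≠ 0 for all i = 0, …, p, the functions w₁, …, w_p satisfy the dressing chain of period p with shift Δ = kω and parameters ε_i = (ν_i − ν_{i+1})·ω: namely −(w_{i+1} + w_i)′ + w_{i+1}² − w_i² = (ν_i − ν_{i+1})·ω for i = 1, …, p−1, −(w₁ + w_p)′ + w₁² − w_p² = (ν_p − ν₁)·ω − kω, and w₁(x)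 + ⋯ + w_p(x) = kωx/2. -/

import Mathlib

/-- The physicists' Hermite polynomials:
`H₀ = 1`, `H₁ = 2x`, `H_{n+1} = 2x·H_n − 2n·H_{n-1}`. -/
noncomputable def hermiteH : ℕ → Polynomial ℝ
  | 0 => 1
  | 1 => Polynomial.C 2 * Polynomial.X
  | n + 2 => Polynomial.C 2 * Polynomial.X * hermiteH (n + 1)
      - Polynomial.C (2 * ((n : ℝ) + 1)) * hermiteH n

/-- The Wronskian of a list of functions: the determinant of the matrix whose
`(i, j)` entry is the `i`-th derivative of the `j`-th function (0-indexed);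
the empty Wronskian is `1`. -/
noncomputable def wronskian (fs : List (ℝ → ℝ)) (z : ℝ) : ℝ :=
  Matrix.det (Matrix.of fun i j : Fin fs.length => iteratedDeriv i.val (fs.get j) z)

/-- The Wronskian `H^S` of the Hermite polynomials indexed by a finite set `S ⊆ ℕ`,
taken in increasing order (`H^∅ = 1`). -/
noncomputable def hermiteWronskian (S : Finset ℕ) (z : ℝ) : ℝ :=
  wronskian ((S.sort (· ≤ ·)).map fun n => fun x => (hermiteH n).eval x) z

section DressingChain

open Polynomial Matrix

section Determinants

variable {ι R : Type*} [Fintype ι] [DecidableEq ι] [CommRing R]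

theorem Matrix.sum_det_updateRow (M V : Matrix ι ι R) :
    ∑ i, (M.updateRow i (V i)).det = (V * M.adjugate).trace := by
  simp only [← cramer_transpose_apply, cramer_eq_adjugate_mulVec, trace, diag_apply, mul_apply,
    mulVec, dotProduct, ← adjugate_transpose, transpose_apply]
  simp only [mul_comm]

theorem Matrix.sum_det_updateRow_mul (M : Matrix ι ι R) (d : ι → R) :
    ∑ i, (M.updateRow i (fun j => d j * M i j)).det = (∑ i, d i) * M.det := by
  have h : M * diagonal d = of fun i j => d j * M i j := by
    ext i j; simp [mul_comm]
  have := sum_det_updateRow M (M * diagonal d)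
  rw [h] at this
  refine this.trans ?_
  rw [← h, Matrix.mul_assoc, trace_mul_comm, Matrix.mul_assoc, adjugate_mul]
  simp [trace_smul, mul_comm]

theorem Matrix.det_updateRow_updateRow_comm (N : Matrix ι ι R) {i j : ι} (hij : i ≠ j)
    (u v : ι → R) :
    ((N.updateRow i u).updateRow j v).det = -((N.updateRow i v).updateRow j u).det := by
  have h : (N.updateRow i u).updateRow j v
      = ((N.updateRow i v).updateRow j u).submatrix (Equiv.swap i j) id := by
    ext a b
    rcases eq_or_ne a i with rfl | ha
    · simp [updateRow_apply, hij]
    rcases eq_or_ne a j with rfl | ha'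
    · simp [updateRow_apply, hij]
    · simp [updateRow_apply, ha, ha', Equiv.swap_apply_of_ne_of_ne ha ha']
  rw [h, det_permute, Equiv.Perm.sign_swap hij]
  simp

theorem Matrix.det_mul_det_updateRow_updateRow (N : Matrix ι ι R) {i j : ι} (hij : i ≠ j)
    (q s : ι → R) :
    N.det * ((N.updateRow i q).updateRow j s).det =
      (N.updateRow i q).det * (N.updateRow j s).det
        - (N.updateRow i s).det * (N.updateRow j q).det := by
  have hq : N.det • q = ∑ k, (N.updateRow k q).det • N k := by
    rw [← det_transpose, ← mulVec_cramer]
    ext l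
    simp [mulVec, dotProduct, cramer_transpose_apply, mul_comm]
  have hφ (v : ι → R) : ((N.updateRow i v).updateRow j s).det =
      cramer (N.updateRow j s)ᵀ v i := by
    rw [cramer_transpose_apply, updateRow_comm _ hij]
  rw [hφ, ← smul_eq_mul, ← Pi.smul_apply, ← map_smul, hq, map_sum, Finset.sum_apply]
  simp only [map_smul, Pi.smul_apply]
  simp only [← hφ]
  rw [← Finset.sum_subset (Finset.subset_univ {i, j}), Finset.sum_pair hij]
  · have h1 : N.updateRow i (N i) = N := updateRow_eq_self N i
    have h2 : (N.updateRow i s).updateRow j (N j) = N.updateRow i s := by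
      rw [updateRow_comm _ hij, updateRow_eq_self]
    rw [h1, det_updateRow_updateRow_comm N hij, h2]
    simp only [smul_eq_mul]
    ring
  · intro k _ hk
    simp only [Finset.mem_insert, Finset.mem_singleton, not_or] at hk
    have : ((N.updateRow i (N k)).updateRow j s).det = 0 :=
      det_zero_of_row_eq (Ne.symm hk.1) (by ext l; simp [updateRow_apply, hk.1, hk.2, hij])
    simp [this]

theorem Matrix.derivative_det (M : Matrix ι ι R[X]) :
    derivative M.det = ∑ i, (M.updateRow i fun j => derivative (M i j)).det := by
  simp only [det_apply', derivative_sum, derivative_mul, derivative_intCast, zero_mul, zero_add,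
    derivative_prod_finset]
  rw [Finset.sum_comm' (t' := Finset.univ) (s' := fun _ => Finset.univ) (by simp)]
  refine Finset.sum_congr rfl fun σ _ => ?_
  rw [Finset.mul_sum]
  refine Eq.trans ?_ (Equiv.sum_comp σ _)
  refine Finset.sum_congr rfl fun i _ => ?_
  rw [← Finset.mul_prod_erase _ _ (Finset.mem_univ i), mul_comm (∏ _ ∈ _, _)]
  congr 2
  · simp
  · refine Finset.prod_congr rfl fun k hk => ?_
    simp [updateRow_apply, Finset.ne_of_mem_erase hk]

end Determinants

section PolynomialWronskian

variable {R : Type*} [CommRing R] {n : ℕ}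

/-- The matrix whose `i`-th row is the `r i`-th derivative of the family `f`. -/
noncomputable def derivMatrix (r : Fin n → ℕ) (f : Fin n → R[X]) : Matrix (Fin n) (Fin n) R[X] :=
  of fun i j => derivative^[r i] (f j)

/-- The Wronskian of a finite family of polynomials, as a polynomial. -/
noncomputable def polyWronskian (f : Fin n → R[X]) : R[X] :=
  (derivMatrix Fin.val f).det

theorem derivMatrix_updateRow (r : Fin n → ℕ) (f : Fin n → R[X]) (i : Fin n) (k : ℕ) :
    (derivMatrix r f).updateRow i (fun j => derivative^[k] (f j)) =
      derivMatrix (Function.update r i k) f := by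
  ext1 a b
  rcases eq_or_ne a i with rfl | ha
  · simp [derivMatrix]
  · simp [derivMatrix, ha]

theorem det_derivMatrix_eq_zero {r : Fin n → ℕ} (f : Fin n → R[X]) {i j : Fin n} (hij : i ≠ j)
    (h : r i = r j) : (derivMatrix r f).det = 0 :=
  det_zero_of_row_eq hij (by ext1 k; simp [derivMatrix, h])

theorem derivative_det_derivMatrix (r : Fin n → ℕ) (f : Fin n → R[X]) :
    derivative (derivMatrix r f).det =
      ∑ i, (derivMatrix (Function.update r i (r i + 1)) f).det := by
  rw [derivative_det]
  refine Finset.sum_congr rfl fun i _ => ?_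
  rw [← derivMatrix_updateRow]
  simp only [derivMatrix, of_apply, Function.iterate_succ_apply']

theorem derivative_polyWronskian (f : Fin (n + 1) → R[X]) :
    derivative (polyWronskian f) =
      (derivMatrix (Function.update (Fin.val (n := n + 1)) (Fin.last n) (n + 1)) f).det := by
  rw [polyWronskian, derivative_det_derivMatrix, Fin.sum_univ_castSucc, Finset.sum_eq_zero]
  · simp
  · intro i _
    refine det_derivMatrix_eq_zero f (i := i.castSucc) (j := i.succ) i.castSucc_lt_succ.ne ?_
    rw [Function.update_self, Function.update_of_ne i.castSucc_lt_succ.ne']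
    simp

theorem det_derivMatrix_update_add_two (f : Fin (n + 1) → R[X]) (i : Fin n) :
    (derivMatrix (Function.update (Fin.val (n := n + 1)) i.castSucc (i + 2)) f).det =
      -(derivMatrix (Function.update
        (Function.update (Fin.val (n := n + 1)) (Fin.last n) (n + 1))
          i.castSucc (i + 1)) f).det := by
  have hlast : i.castSucc ≠ Fin.last n := (Fin.castSucc_lt_last i).ne
  rcases (Nat.succ_le_of_lt i.isLt).eq_or_lt with h | h
  · have h' : (i : ℕ) + 1 = n := h
    have hself (k : ℕ) : Function.update (Function.update (Fin.val (n := n + 1))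
        i.castSucc k) (Fin.last n) n = Function.update Fin.val i.castSucc k := by
      rw [Function.update_eq_self_iff, Function.update_of_ne hlast.symm, Fin.val_last]
    have key := det_updateRow_updateRow_comm (derivMatrix (Fin.val (n := n + 1)) f) hlast
      (fun j => derivative^[n + 1] (f j)) (fun j => derivative^[n] (f j))
    simp only [derivMatrix_updateRow, hself] at key
    rw [Function.update_comm hlast.symm, h', show (i : ℕ) + 2 = n + 1 by omega, key]
  · have h' : (i : ℕ) + 1 < n := h
    rw [det_derivMatrix_eq_zero f (i := i.castSucc) (j := ⟨i + 2, by omega⟩),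
      det_derivMatrix_eq_zero f (i := i.castSucc) (j := ⟨i + 1, by omega⟩), neg_zero]
    · simp [Fin.ext_iff]
    · rw [Function.update_self, Function.update_of_ne, Function.update_of_ne]
      · simp [Fin.ext_iff]; omega
      · simp [Fin.ext_iff]
    · simp [Fin.ext_iff]
    · rw [Function.update_self, Function.update_of_ne]
      simp [Fin.ext_iff]

theorem derivative_derivative_polyWronskian (f : Fin (n + 1) → R[X]) :
    derivative (derivative (polyWronskian f)) =
      (derivMatrix (Function.update (Fin.val (n := n + 1)) (Fin.last n) (n + 2)) f).det -
      ∑ i : Fin n,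
        (derivMatrix (Function.update (Fin.val (n := n + 1)) i.castSucc (i + 2)) f).det := by
  rw [derivative_polyWronskian, derivative_det_derivMatrix, Fin.sum_univ_castSucc, add_comm,
    sub_eq_add_neg, ← Finset.sum_neg_distrib]
  congr 1
  · simp
  · refine Finset.sum_congr rfl fun i _ => ?_
    rw [det_derivMatrix_update_add_two, neg_neg,
      Function.update_of_ne (Fin.castSucc_lt_last i).ne, Fin.val_castSucc]

theorem derivative_derivative_polyWronskian' (f : Fin (n + 2) → R[X]) :
    derivative (derivative (polyWronskian f)) =
      (derivMatrix (Function.update (Fin.val (n := n + 2)) (Fin.last _) (n + 3)) f).det +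
      (derivMatrix (Function.update (Function.update (Fin.val (n := n + 2))
        (Fin.last n).castSucc (n + 1)) (Fin.last _) (n + 2)) f).det := by
  rw [derivative_derivative_polyWronskian, sub_eq_add_neg, ← Finset.sum_neg_distrib,
    Fin.sum_univ_castSucc, Finset.sum_eq_zero, zero_add]
  · congr 1
    rw [det_derivMatrix_update_add_two, neg_neg,
      Function.update_comm (Fin.castSucc_lt_last _).ne, Fin.val_last]
  · intro i _
    rw [neg_eq_zero]
    refine det_derivMatrix_eq_zero f (i := i.castSucc.castSucc) (j := i.succ.succ) ?_ ?_
    · simp [Fin.ext_iff]; omega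
    · rw [Function.update_self, Function.update_of_ne]
      · simp
      · simp [Fin.ext_iff]; omega

/-- A three-term Plücker relation between the Wronskians of `f` and of `f` without its last
member. -/
theorem polyWronskian_plucker (f : Fin (n + 2) → R[X]) :
    polyWronskian (f ∘ Fin.castSucc) * (derivative (derivative (polyWronskian f)) -
      (derivMatrix (Function.update (Fin.val (n := n + 2)) (Fin.last _) (n + 3)) f).det)
      = derivative (polyWronskian (f ∘ Fin.castSucc)) * derivative (polyWronskian f) -
        (derivMatrix (Function.update (Fin.val (n := n + 1)) (Fin.last n) (n + 2))
          (f ∘ Fin.castSucc)).det * polyWronskian f := by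
  set e : Fin (n + 2) → R[X] := Pi.single (Fin.last _) 1 with he
  have hext (r : Fin (n + 2) → ℕ) : ((derivMatrix r f).updateRow (Fin.last _) e).det =
      (derivMatrix (r ∘ Fin.castSucc) (f ∘ Fin.castSucc)).det := by
    rw [det_succ_row _ (Fin.last _), Finset.sum_eq_single (Fin.last _)]
    · simp only [updateRow_self, he, Pi.single_eq_same, mul_one, Fin.succAbove_last]
      rw [Even.neg_one_pow (by simp), one_mul]
      congr 1
      ext1 i j
      simp [derivMatrix, updateRow_apply, (Fin.castSucc_lt_last i).ne]
    · intro j _ hj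
      simp [he, hj]
    · simp
  have hne : (Fin.last n).castSucc ≠ Fin.last (n + 1) := (Fin.castSucc_lt_last _).ne
  have hcomp (k : ℕ) : Function.update (Fin.val (n := n + 2)) (Fin.last n).castSucc k ∘
      Fin.castSucc = Function.update (Fin.val (n := n + 1)) (Fin.last n) k := by
    rw [Function.update_comp_eq_of_injective _ (Fin.castSucc_injective _)]
    rfl
  have key := det_mul_det_updateRow_updateRow
    ((derivMatrix (Fin.val (n := n + 2)) f).updateRow (Fin.last _) e) hne
    (fun j => derivative^[n + 1] (f j)) (fun j => derivative^[n + 2] (f j))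
  have hcomm (v : Fin (n + 2) → R[X]) : ((derivMatrix (Fin.val (n := n + 2)) f).updateRow
      (Fin.last _) e).updateRow (Fin.last n).castSucc v =
        ((derivMatrix (Fin.val (n := n + 2)) f).updateRow (Fin.last n).castSucc v).updateRow
          (Fin.last _) e :=
    updateRow_comm _ hne.symm _ _
  have hself : Function.update (Fin.val (n := n + 2)) (Fin.last _) (n + 1) =
      Fin.val := by
    rw [Function.update_eq_self_iff, Fin.val_last]
  simp only [hcomm, updateRow_idem, derivMatrix_updateRow, hext, hcomp, hself] at key
  rw [derivative_derivative_polyWronskian', derivative_polyWronskian, derivative_polyWronskian,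
    add_sub_cancel_left]
  exact key

theorem iterate_derivative_hermiteOperator (f : R[X]) (k : ℕ) :
    derivative^[k] (derivative (derivative f) - 2 * X * derivative f) =
      derivative^[k + 2] f - 2 * X * derivative^[k + 1] f - 2 * (k : R[X]) * derivative^[k] f := by
  induction k with
  | zero => simp
  | succ k ih =>
    rw [Function.iterate_succ_apply', ih]
    simp only [derivative_sub, derivative_mul, derivative_X, derivative_natCast,
      ← Function.iterate_succ_apply' derivative, derivative_ofNat]
    push_cast
    ring

/-- The effect on a Wronskian of the Hermite operator `D ^ 2 - 2 X D`, of which all members of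
the family are eigenvectors. -/
theorem polyWronskian_of_eigen (f : Fin (n + 1) → R[X]) (d : Fin (n + 1) → R[X])
    (hf : ∀ j, derivative (derivative (f j)) - 2 * X * derivative (f j) = d j * f j)
    (hd : ∀ j, derivative (d j) = 0) :
    2 * (derivMatrix (Function.update (Fin.val (n := n + 1)) (Fin.last n) (n + 2)) f).det
        - derivative (derivative (polyWronskian f)) - 2 * X * derivative (polyWronskian f)
        - ((n : R[X]) * ((n : R[X]) + 1)) * polyWronskian f = (∑ j, d j) * polyWronskian f := by
  have hiter (j : Fin (n + 1)) (k : ℕ) :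
      derivative^[k] (d j * f j) = d j * derivative^[k] (f j) := by
    induction k with
    | zero => rfl
    | succ k ih => rw [Function.iterate_succ_apply', ih, derivative_mul, hd, zero_mul, zero_add,
        ← Function.iterate_succ_apply' derivative]
  have hgauss : 2 * ∑ i : Fin (n + 1), ((i : ℕ) : R[X]) = (n : R[X]) * ((n : R[X]) + 1) := by
    have := Finset.sum_range_id_mul_two (n + 1)
    rw [← Fin.sum_univ_eq_sum_range (fun i => i)] at this
    have := congrArg (Nat.cast (R := R[X])) this
    push_cast [Nat.add_sub_cancel] at this
    linear_combination this
  have hrow (i : Fin (n + 1)) :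
      ((derivMatrix Fin.val f).updateRow i fun j => d j * derivMatrix Fin.val f i j).det =
        (derivMatrix (Function.update (Fin.val (n := n + 1)) i (i + 2)) f).det -
        2 * X * (derivMatrix (Function.update (Fin.val (n := n + 1)) i (i + 1)) f).det -
        2 * ((i : ℕ) : R[X]) * (derivMatrix (Fin.val (n := n + 1)) f).det := by
    have hV : (fun j => d j * derivMatrix Fin.val f i j) =
        (fun j => derivative^[i + 2] (f j)) + (-(2 * X : R[X])) • (fun j => derivative^[i + 1] (f j))
          + (-(2 * ((i : ℕ) : R[X]))) • fun j => derivative^[i] (f j) := by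
      ext1 j
      simp only [derivMatrix, of_apply, ← hiter, ← hf, iterate_derivative_hermiteOperator,
        Pi.add_apply, Pi.smul_apply, smul_eq_mul]
      ring
    rw [hV, det_updateRow_add, det_updateRow_add, det_updateRow_smul, det_updateRow_smul,
      derivMatrix_updateRow, derivMatrix_updateRow, derivMatrix_updateRow, Function.update_eq_self]
    ring
  have hsum := sum_det_updateRow_mul (derivMatrix Fin.val f) d
  simp only [hrow, Finset.sum_sub_distrib, ← Finset.mul_sum, ← Finset.sum_mul, hgauss] at hsum
  rw [← derivative_det_derivMatrix, Fin.sum_univ_castSucc] at hsum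
  simp only [Fin.val_castSucc, Fin.val_last] at hsum
  have h2 := derivative_derivative_polyWronskian f
  simp only [polyWronskian] at h2 ⊢
  linear_combination hsum - h2

/-- The bilinear relation between the Wronskians of a family of eigenvectors of the Hermite
operator and of the family obtained by omitting its last member. -/
theorem polyWronskian_bilinear (f : Fin (n + 1) → R[X]) (d : Fin (n + 1) → R[X])
    (hf : ∀ j, derivative (derivative (f j)) - 2 * X * derivative (f j) = d j * f j)
    (hd : ∀ j, derivative (d j) = 0) :
    polyWronskian (f ∘ Fin.castSucc) * derivative (derivative (polyWronskian f))
      - 2 * derivative (polyWronskian (f ∘ Fin.castSucc)) * derivative (polyWronskian f)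
      + derivative (derivative (polyWronskian (f ∘ Fin.castSucc))) * polyWronskian f
      - 2 * X * (polyWronskian (f ∘ Fin.castSucc) * derivative (polyWronskian f)
        - derivative (polyWronskian (f ∘ Fin.castSucc)) * polyWronskian f)
      = (d (Fin.last n) + 2 * (n : R[X])) * polyWronskian (f ∘ Fin.castSucc) * polyWronskian f := by
  cases n with
  | zero =>
    have h0 : polyWronskian (f ∘ Fin.castSucc) = 1 := by simp [polyWronskian]
    have h1 : polyWronskian f = f 0 := by simp [polyWronskian, derivMatrix]
    have := hf 0
    rw [h0, h1]
    simp only [derivative_one, derivative_zero, Nat.cast_zero, Fin.last_zero]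
    linear_combination this
  | succ n =>
    have hA := polyWronskian_of_eigen (f ∘ Fin.castSucc) (d ∘ Fin.castSucc) (fun j => hf _)
      (fun j => hd _)
    have hB := polyWronskian_of_eigen f d hf hd
    have hP := polyWronskian_plucker f
    rw [Fin.sum_univ_castSucc] at hB
    simp only [Function.comp_apply] at hA
    push_cast at hA hB ⊢
    linear_combination polyWronskian (f ∘ Fin.castSucc) * hB - polyWronskian f * hA + 2 * hP

end PolynomialWronskian

section HermiteWronskian

theorem derivative_hermiteH_succ (n : ℕ) :
    derivative (hermiteH (n + 1)) = C (2 * ((n : ℝ) + 1)) * hermiteH n := by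
  induction n using Nat.twoStepInduction with
  | zero => simp [hermiteH]
  | one =>
    simp only [hermiteH, derivative_sub, derivative_mul, derivative_C, derivative_X, derivative_one]
    simp only [map_mul, map_add, map_one, map_natCast, map_ofNat]
    push_cast
    ring
  | more n ih₁ ih₂ =>
    rw [hermiteH, derivative_sub, derivative_mul, ih₂, derivative_C_mul, derivative_C_mul, ih₁,
      derivative_X, hermiteH]
    simp only [map_mul, map_add, map_one, map_natCast,
      map_ofNat]
    push_cast
    ring

theorem hermiteH_succ (n : ℕ) :
    hermiteH (n + 1) = 2 * X * hermiteH n - derivative (hermiteH n) := by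
  cases n with
  | zero => simp [hermiteH, map_ofNat]
  | succ n => rw [derivative_hermiteH_succ, hermiteH, map_ofNat]

theorem hermiteH_eigen (n : ℕ) :
    derivative (derivative (hermiteH n)) - 2 * X * derivative (hermiteH n) =
      C (-2 * (n : ℝ)) * hermiteH n := by
  cases n with
  | zero => simp [hermiteH]
  | succ n =>
    rw [derivative_hermiteH_succ, hermiteH_succ]
    rw [derivative_mul, derivative_C]
    simp only [map_mul, map_add, map_one, map_natCast, map_neg, map_ofNat]
    push_cast
    ring

/-- The Wronskian `H^S` as a polynomial. -/
noncomputable def hermiteWronskianPoly (S : Finset ℕ) : ℝ[X] :=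
  polyWronskian fun i : Fin S.card => hermiteH (S.orderEmbOfFin rfl i)

theorem hermiteWronskian_eq_eval (S : Finset ℕ) (z : ℝ) :
    hermiteWronskian S z = (hermiteWronskianPoly S).eval z := by
  have hlen : S.card = ((S.sort (· ≤ ·)).map fun n => fun x => (hermiteH n).eval x).length := by
    simp
  have hiter (p : ℝ[X]) (k : ℕ) :
      iteratedDeriv k (fun x => p.eval x) = fun x => (derivative^[k] p).eval x := by
    induction k with
    | zero => simp
    | succ k ih =>
      ext x
      rw [iteratedDeriv_succ, ih, Polynomial.deriv, Function.iterate_succ_apply']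
  rw [hermiteWronskian, _root_.wronskian, hermiteWronskianPoly, polyWronskian, ← coe_evalRingHom,
    RingHom.map_det, ← det_submatrix_equiv_self (finCongr hlen)]
  congr 1
  ext i j
  simp [derivMatrix, Finset.orderEmbOfFin_apply, hiter]

theorem exists_hermiteWronskianPoly_eq {n : ℕ} (S : Finset ℕ) (a : Fin n → ℕ)
    (ha : Function.Injective a) (hS : Finset.univ.image a = S) :
    ∃ c : ℝ, c ≠ 0 ∧ hermiteWronskianPoly S = C c * polyWronskian fun i => hermiteH (a i) := by
  obtain rfl : S.card = n := by simp [← hS, Finset.card_image_of_injective _ ha]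
  have hmem (i : Fin S.card) : a i ∈ S := hS ▸ Finset.mem_image_of_mem a (Finset.mem_univ i)
  let g : Fin S.card → Fin S.card := fun i => (S.orderIsoOfFin rfl).symm ⟨a i, hmem i⟩
  have hg : Function.Injective g := fun i j hij =>
    ha (congrArg Subtype.val ((S.orderIsoOfFin rfl).symm.injective hij))
  let σ : Equiv.Perm (Fin S.card) := Equiv.ofBijective g (Finite.injective_iff_bijective.mp hg)
  have hσ (i : Fin S.card) : S.orderEmbOfFin rfl (σ i) = a i := by
    rw [← Finset.coe_orderIsoOfFin_apply]
    exact congrArg Subtype.val ((S.orderIsoOfFin rfl).apply_symm_apply ⟨a i, hmem i⟩)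
  have hdet : (polyWronskian fun i => hermiteH (a i)) =
      ((Equiv.Perm.sign σ : ℤ) : ℝ[X]) * hermiteWronskianPoly S := by
    rw [hermiteWronskianPoly, polyWronskian, polyWronskian, ← det_permute']
    congr 1
    ext1 i j
    simp [derivMatrix, hσ]
  refine ⟨((Equiv.Perm.sign σ : ℤ) : ℝ), by simp, ?_⟩
  rw [hdet, ← mul_assoc, map_intCast, ← Int.cast_mul, ← Units.val_mul, Int.units_mul_self]
  simp

theorem exists_hermiteWronskianPoly_insert_zero (S : Finset ℕ) :
    ∃ c : ℝ, c ≠ 0 ∧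
      hermiteWronskianPoly (insert 0 (S.image (· + 1))) = C c * hermiteWronskianPoly S := by
  have hinj : Function.Injective (Fin.cons 0 fun i => S.orderEmbOfFin rfl i + 1 :
      Fin (S.card + 1) → ℕ) := by
    rw [Fin.cons_injective_iff]
    refine ⟨by simp, fun i j h => ?_⟩
    simpa using h
  obtain ⟨c, hc, h⟩ := exists_hermiteWronskianPoly_eq (insert 0 (S.image (· + 1))) _ hinj (by
    ext m
    simp only [Finset.mem_image, Finset.mem_univ, true_and, Fin.exists_fin_succ, Fin.cons_zero,
      Fin.cons_succ, Finset.mem_insert]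
    have hr := Set.ext_iff.mp (S.range_orderEmbOfFin rfl)
    simp only [Set.mem_range, Finset.mem_coe] at hr
    simp only [← hr, exists_exists_eq_and, eq_comm (b := m)])
  refine ⟨c * ∏ i : Fin S.card, (2 * ((S.orderEmbOfFin rfl i : ℝ) + 1)),
    mul_ne_zero hc (Finset.prod_ne_zero_iff.mpr fun i _ => by positivity), ?_⟩
  rw [h, map_mul, mul_assoc]
  congr 1
  rw [polyWronskian, det_succ_column_zero, Finset.sum_eq_single 0]
  · rw [map_prod, hermiteWronskianPoly, polyWronskian, ← det_mul_row]
    simp only [derivMatrix, of_apply, Fin.val_zero, Function.iterate_zero, id, Fin.cons_zero,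
      hermiteH, pow_zero, one_mul]
    congr 1
    ext1 i j
    simp only [of_apply, submatrix_apply, Fin.succAbove_zero, Fin.cons_succ, Fin.val_succ,
      Function.iterate_succ_apply, derivative_hermiteH_succ, iterate_derivative_C_mul]
  · intro i _ hi
    obtain ⟨j, rfl⟩ := Fin.exists_succ_eq.mpr hi
    simp [derivMatrix, hermiteH]
  · simp

theorem exists_hermiteWronskianPoly_shift (S : Finset ℕ) (k : ℕ) :
    ∃ c : ℝ, c ≠ 0 ∧ hermiteWronskianPoly (Finset.range k ∪ S.image (· + k)) =
      C c * hermiteWronskianPoly S := by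
  induction k with
  | zero => exact ⟨1, one_ne_zero, by simp⟩
  | succ k ih =>
    obtain ⟨c, hc, h⟩ := ih
    obtain ⟨c', hc', h'⟩ :=
      exists_hermiteWronskianPoly_insert_zero (Finset.range k ∪ S.image (· + k))
    refine ⟨c' * c, mul_ne_zero hc' hc, ?_⟩
    rw [map_mul, mul_assoc, ← h, ← h']
    congr 1
    rw [Finset.image_union, Finset.image_image, Finset.range_add_one', ← Finset.insert_union]
    congr 2
    rw [Finset.map_eq_image]
    rfl

theorem hermiteWronskianPoly_bilinear (S : Finset ℕ) {ν : ℕ} (hν : ν ∉ S) :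
    hermiteWronskianPoly S * derivative (derivative (hermiteWronskianPoly (insert ν S)))
      - 2 * derivative (hermiteWronskianPoly S) * derivative (hermiteWronskianPoly (insert ν S))
      + derivative (derivative (hermiteWronskianPoly S)) * hermiteWronskianPoly (insert ν S)
      - 2 * X * (hermiteWronskianPoly S * derivative (hermiteWronskianPoly (insert ν S))
        - derivative (hermiteWronskianPoly S) * hermiteWronskianPoly (insert ν S))
      = C (2 * (S.card : ℝ) - 2 * ν) * hermiteWronskianPoly S *
        hermiteWronskianPoly (insert ν S) := by
  set a : Fin (S.card + 1) → ℕ := Fin.snoc (S.orderEmbOfFin rfl) ν with ha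
  have hr := Set.ext_iff.mp (S.range_orderEmbOfFin rfl)
  simp only [Set.mem_range, Finset.mem_coe] at hr
  obtain ⟨c, -, h⟩ := exists_hermiteWronskianPoly_eq (insert ν S) a
    (Fin.snoc_injective_iff.mpr ⟨(S.orderEmbOfFin rfl).injective, by simpa using hν⟩) (by
      ext m
      simp only [Finset.mem_image, Finset.mem_univ, true_and, Fin.exists_fin_succ', ha,
        Fin.snoc_castSucc, Fin.snoc_last, Finset.mem_insert, hr, or_comm, eq_comm (a := ν)])
  have hS : hermiteWronskianPoly S = polyWronskian ((fun i => hermiteH (a i)) ∘ Fin.castSucc) := by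
    simp [hermiteWronskianPoly, ha, Function.comp_def]
  have key := polyWronskian_bilinear (fun i => hermiteH (a i)) (fun i => C (-2 * (a i : ℝ)))
    (fun i => hermiteH_eigen _) (fun i => derivative_C)
  have hlast : a (Fin.last _) = ν := by simp [ha]
  rw [← hS, hlast] at key
  rw [h]
  simp only [derivative_C_mul, map_sub, map_mul, map_neg, map_natCast, map_ofNat] at key ⊢
  linear_combination C c * key

/-- The logarithmic derivative of `H^S`. -/
noncomputable def hermiteLogDeriv (S : Finset ℕ) (z : ℝ) : ℝ :=
  (derivative (hermiteWronskianPoly S)).eval z / (hermiteWronskianPoly S).eval z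

theorem hasDerivAt_hermiteLogDeriv {S : Finset ℕ} {z : ℝ}
    (h : (hermiteWronskianPoly S).eval z ≠ 0) :
    HasDerivAt (hermiteLogDeriv S) (deriv (hermiteLogDeriv S) z) z :=
  (((derivative (hermiteWronskianPoly S)).hasDerivAt z).div
    ((hermiteWronskianPoly S).hasDerivAt z) h).differentiableAt.hasDerivAt

theorem deriv_hermiteLogDeriv {S : Finset ℕ} {z : ℝ} (h : (hermiteWronskianPoly S).eval z ≠ 0) :
    deriv (hermiteLogDeriv S) z =
      (derivative (derivative (hermiteWronskianPoly S))).eval z / (hermiteWronskianPoly S).eval z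
        - hermiteLogDeriv S z ^ 2 := by
  refine (((derivative (hermiteWronskianPoly S)).hasDerivAt z).div
    ((hermiteWronskianPoly S).hasDerivAt z) h).deriv.trans ?_
  rw [hermiteLogDeriv]
  field_simp

theorem deriv_log_hermiteWronskian_div {S T : Finset ℕ} {z : ℝ}
    (hS : (hermiteWronskianPoly S).eval z ≠ 0) (hT : (hermiteWronskianPoly T).eval z ≠ 0) :
    deriv (fun z => Real.log (hermiteWronskian S z / hermiteWronskian T z)) z =
      hermiteLogDeriv S z - hermiteLogDeriv T z := by
  simp only [hermiteWronskian_eq_eval]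
  refine ((((hermiteWronskianPoly S).hasDerivAt z).div
    ((hermiteWronskianPoly T).hasDerivAt z) hT).log (div_ne_zero hS hT)).deriv.trans ?_
  rw [hermiteLogDeriv, hermiteLogDeriv]
  simp only [Pi.div_apply]
  field_simp

theorem hermiteLogDeriv_bilinear {S : Finset ℕ} {ν : ℕ} (hν : ν ∉ S) {z : ℝ}
    (hS : (hermiteWronskianPoly S).eval z ≠ 0)
    (hT : (hermiteWronskianPoly (insert ν S)).eval z ≠ 0) :
    deriv (hermiteLogDeriv (insert ν S)) z + deriv (hermiteLogDeriv S) z +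
      (hermiteLogDeriv (insert ν S) z - hermiteLogDeriv S z) ^ 2 -
      2 * z * (hermiteLogDeriv (insert ν S) z - hermiteLogDeriv S z) =
        2 * (S.card : ℝ) - 2 * ν := by
  have key := congrArg (eval z) (hermiteWronskianPoly_bilinear S hν)
  simp only [eval_add, eval_sub, eval_mul, eval_X, eval_C, eval_ofNat] at key
  rw [deriv_hermiteLogDeriv hS, deriv_hermiteLogDeriv hT, hermiteLogDeriv, hermiteLogDeriv]
  field_simp
  linear_combination (hermiteWronskianPoly S).eval z *
    (hermiteWronskianPoly (insert ν S)).eval z * key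

theorem symmDiff_singleton_of_mem {S : Finset ℕ} {ν : ℕ} (hν : ν ∈ S) :
    symmDiff S {ν} = S.erase ν := by
  ext m
  by_cases hm : m = ν <;> simp [Finset.mem_symmDiff, hm, hν]

theorem symmDiff_singleton_of_notMem {S : Finset ℕ} {ν : ℕ} (hν : ν ∉ S) :
    symmDiff S {ν} = insert ν S := by
  ext m
  by_cases hm : m = ν <;> simp [Finset.mem_symmDiff, hm, hν]

/-- The potential attached to the Maya diagram `S` in the Schrödinger operator. -/
noncomputable def hermitePotential (S : Finset ℕ) (z : ℝ) : ℝ :=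
  z ^ 2 + 2 * S.card - 2 * deriv (hermiteLogDeriv S) z

/-- The two Riccati equations satisfied by the superpotential of a flip. -/
theorem hermite_riccati (S : Finset ℕ) (ν : ℕ) {z : ℝ}
    (hS : (hermiteWronskianPoly S).eval z ≠ 0)
    (hT : (hermiteWronskianPoly (symmDiff S {ν})).eval z ≠ 0) :
    ((if ν ∈ S then (-1 : ℝ) else 1) * z + hermiteLogDeriv S z
        - hermiteLogDeriv (symmDiff S {ν}) z) ^ 2
      - ((if ν ∈ S then (-1 : ℝ) else 1) + deriv (hermiteLogDeriv S) z
        - deriv (hermiteLogDeriv (symmDiff S {ν})) z) = hermitePotential S z - 2 * ν - 1 ∧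
    ((if ν ∈ S then (-1 : ℝ) else 1) * z + hermiteLogDeriv S z
        - hermiteLogDeriv (symmDiff S {ν}) z) ^ 2
      + ((if ν ∈ S then (-1 : ℝ) else 1) + deriv (hermiteLogDeriv S) z
        - deriv (hermiteLogDeriv (symmDiff S {ν})) z) =
          hermitePotential (symmDiff S {ν}) z - 2 * ν - 1 := by
  simp only [hermitePotential]
  by_cases hν : ν ∈ S
  · obtain ⟨T, hνT, rfl⟩ : ∃ T, ν ∉ T ∧ insert ν T = S :=
      ⟨S.erase ν, Finset.notMem_erase ν S, Finset.insert_erase hν⟩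
    have hsymm := symmDiff_singleton_of_mem hν
    rw [Finset.erase_insert hνT] at hsymm
    rw [hsymm] at hT ⊢
    have key := hermiteLogDeriv_bilinear hνT hT hS
    rw [if_pos hν, Finset.card_insert_of_notMem hνT]
    push_cast
    constructor <;> linear_combination key
  · have hsymm := symmDiff_singleton_of_notMem hν
    rw [hsymm] at hT ⊢
    have key := hermiteLogDeriv_bilinear hν hS hT
    rw [if_neg hν, Finset.card_insert_of_notMem hν]
    push_cast
    constructor <;> linear_combination key

theorem card_symmDiff_singleton (S : Finset ℕ) (ν : ℕ) :
    ((symmDiff S {ν}).card : ℝ) - S.card = if ν ∈ S then -1 else 1 := by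
  by_cases hν : ν ∈ S
  · rw [symmDiff_singleton_of_mem hν, if_pos hν, ← Finset.card_erase_add_one hν]
    push_cast
    ring
  · rw [symmDiff_singleton_of_notMem hν, if_neg hν, Finset.card_insert_of_notMem hν]
    push_cast
    ring

theorem hermiteLogDeriv_shift (S : Finset ℕ) (k : ℕ) :
    hermiteLogDeriv (Finset.range k ∪ S.image (· + k)) = hermiteLogDeriv S := by
  obtain ⟨c, hc, h⟩ := exists_hermiteWronskianPoly_shift S k
  ext z
  rw [hermiteLogDeriv, h, derivative_C_mul, eval_C_mul, eval_C_mul, mul_div_mul_left _ _ hc,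
    hermiteLogDeriv]

theorem card_range_union_image_add (S : Finset ℕ) (k : ℕ) :
    (Finset.range k ∪ S.image (· + k)).card = k + S.card := by
  rw [Finset.card_union_of_disjoint, Finset.card_range,
    Finset.card_image_of_injective _ (add_left_injective k)]
  rw [Finset.disjoint_left]
  intro a ha ha'
  obtain ⟨b, -, rfl⟩ := Finset.mem_image.mp ha'
  simp at ha

end HermiteWronskian

end DressingChain

/-- rational solutions of the odd-periodic dressing chains from cyclic
Maya diagrams: let `ω > 0`, `p, k ≥ 1`, let `M₀` be a finite set of positive
integers, let `ν₁, …, ν_p` be flip levels with `Mᵢ = M_{i-1} Δ {νᵢ}` and the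
cyclicity condition `M_p = {0, …, k-1} ∪ (M₀ + k)`.  With `z = √(ω/2)·x`, define
`wᵢ(x) = σᵢ·ωx/2 + √(ω/2)·(d/dz)[log(H^{M_{i-1}}(z)/H^{Mᵢ}(z))]`, where `σᵢ = −1`
for a positive flip (`νᵢ ∈ M_{i-1}`) and `σᵢ = +1` for a negative flip.  Then at
every `x` where all the Hermite Wronskians `H^{Mᵢ}` are nonzero, `w₁, …, w_p`
solve the period-`p` dressing chain with shift `Δ = kω` and parameters
`εᵢ = (νᵢ − ν_{i+1})·ω`. -/
theorem odd_dressing_chain_rational_solutions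
    (ω : ℝ) (hω : 0 < ω) (p k : ℕ) (hp : 1 ≤ p) (hk : 1 ≤ k)
    (M0 : Finset ℕ) (hM0 : ∀ n ∈ M0, 1 ≤ n)
    (ν : Fin p → ℕ)
    (Ms : Fin (p + 1) → Finset ℕ)
    (hMs0 : Ms 0 = M0)
    (hMstep : ∀ i : Fin p, Ms i.succ = symmDiff (Ms i.castSucc) {ν i})
    (hcyc : Ms (Fin.last p) = Finset.range k ∪ M0.image (· + k))
    (w : Fin p → ℝ → ℝ)
    (hw : ∀ (i : Fin p) (x : ℝ),
      w i x = (if ν i ∈ Ms i.castSucc then (-1 : ℝ) else 1) * ω * x / 2 +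
        Real.sqrt (ω / 2) *
          deriv (fun z => Real.log
              (hermiteWronskian (Ms i.castSucc) z / hermiteWronskian (Ms i.succ) z))
            (Real.sqrt (ω / 2) * x)) :
    ∀ x : ℝ,
      (∀ i : Fin (p + 1), hermiteWronskian (Ms i) (Real.sqrt (ω / 2) * x) ≠ 0) →
      (∀ i j : Fin p, (j : ℕ) = (i : ℕ) + 1 →
        -(deriv (w j) x + deriv (w i) x) + (w j x) ^ 2 - (w i x) ^ 2
          = ((ν i : ℝ) - (ν j : ℝ)) * ω) ∧
      (-(deriv (w ⟨0, by omega⟩) x + deriv (w ⟨p - 1, by omega⟩) x)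
          + (w ⟨0, by omega⟩ x) ^ 2 - (w ⟨p - 1, by omega⟩ x) ^ 2
          = ((ν ⟨p - 1, by omega⟩ : ℝ) - (ν ⟨0, by omega⟩ : ℝ)) * ω - (k : ℝ) * ω) ∧
      (∑ i : Fin p, w i x) = (k : ℝ) * ω * x / 2 := by
  intro x hx
  set s := Real.sqrt (ω / 2) with hs
  have hs2 : s ^ 2 = ω / 2 := Real.sq_sqrt (by positivity)
  have hne (i : Fin (p + 1)) : (hermiteWronskianPoly (Ms i)).eval (s * x) ≠ 0 := by
    rw [← hermiteWronskian_eq_eval]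
    exact hx i
  set σ : Fin p → ℝ := fun i => if ν i ∈ Ms i.castSucc then -1 else 1 with hσ
  set u : Fin p → ℝ → ℝ := fun i z =>
    σ i * z + hermiteLogDeriv (Ms i.castSucc) z - hermiteLogDeriv (Ms i.succ) z with hu
  set u' : Fin p → ℝ := fun i => σ i + deriv (hermiteLogDeriv (Ms i.castSucc)) (s * x)
    - deriv (hermiteLogDeriv (Ms i.succ)) (s * x) with hu'
  have hw_eq (i : Fin p) (y : ℝ) (h₁ : (hermiteWronskianPoly (Ms i.castSucc)).eval (s * y) ≠ 0)
      (h₂ : (hermiteWronskianPoly (Ms i.succ)).eval (s * y) ≠ 0) : w i y = s * u i (s * y) := by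
    rw [hw, deriv_log_hermiteWronskian_div h₁ h₂]
    simp only [hu, hσ]
    linear_combination -(if ν i ∈ Ms i.castSucc then (-1 : ℝ) else 1) * y * hs2
  have hwx (i : Fin p) : w i x = s * u i (s * x) := hw_eq i x (hne _) (hne _)
  have hlin : HasDerivAt (fun y => s * y) s x := by
    simpa using (hasDerivAt_id x).const_mul s
  have hwd (i : Fin p) : deriv (w i) x = ω / 2 * u' i := by
    have hnear (j : Fin (p + 1)) :
        ∀ᶠ y in nhds x, (hermiteWronskianPoly (Ms j)).eval (s * y) ≠ 0 :=
      (((hermiteWronskianPoly (Ms j)).continuous.comp (continuous_const_mul s)).continuousAt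
        (x := x)).eventually_ne (hne j)
    have heq : w i =ᶠ[nhds x] fun y => s * u i (s * y) := by
      filter_upwards [hnear i.castSucc, hnear i.succ] with y h₁ h₂ using hw_eq i y h₁ h₂
    have hud : HasDerivAt (u i) (u' i) (s * x) := by
      have := (((hasDerivAt_id (s * x)).const_mul (σ i)).add
        (hasDerivAt_hermiteLogDeriv (hne i.castSucc))).sub
        (hasDerivAt_hermiteLogDeriv (hne i.succ))
      rw [mul_one] at this
      exact this
    have hsu : HasDerivAt (fun y => s * u i (s * y)) (s * (u' i * s)) x :=
      (hud.comp x hlin).const_mul s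
    rw [heq.deriv_eq, hsu.deriv, ← hs2]
    ring
  have hricc (i : Fin p) :
      u i (s * x) ^ 2 - u' i = hermitePotential (Ms i.castSucc) (s * x) - 2 * ν i - 1 ∧
      u i (s * x) ^ 2 + u' i = hermitePotential (Ms i.succ) (s * x) - 2 * ν i - 1 := by
    have h₂ := hne i.succ
    simp only [hu, hu', hσ]
    rw [hMstep i] at h₂ ⊢
    exact hermite_riccati _ _ (hne i.castSucc) h₂
  have hchain (i j : Fin p) : -(deriv (w j) x + deriv (w i) x) + w j x ^ 2 - w i x ^ 2 =
      ω / 2 * (hermitePotential (Ms j.castSucc) (s * x) - hermitePotential (Ms i.succ) (s * x)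
        + 2 * (ν i : ℝ) - 2 * ν j) := by
    rw [hwd, hwd, hwx, hwx]
    linear_combination (u j (s * x) ^ 2 - u i (s * x) ^ 2) * hs2 +
      ω / 2 * (hricc j).1 - ω / 2 * (hricc i).2
  refine ⟨fun i j hij => ?_, ?_, ?_⟩
  · have hij' : j.castSucc = i.succ := Fin.ext (by simpa using hij)
    rw [hchain, hij']
    ring
  · have h0 : (⟨0, by omega⟩ : Fin p).castSucc = 0 := rfl
    have hlast : (⟨p - 1, by omega⟩ : Fin p).succ = Fin.last p :=
      Fin.ext (by simp only [Fin.succ_mk, Fin.val_last]; omega)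
    rw [hchain, h0, hlast, hcyc, hMs0, hermitePotential, hermitePotential, hermiteLogDeriv_shift,
      card_range_union_image_add]
    push_cast
    ring
  · have hσ' (i : Fin p) : σ i = ((Ms i.succ).card : ℝ) - (Ms i.castSucc).card := by
      rw [hMstep, card_symmDiff_singleton]
    have htel (g : Finset ℕ → ℝ) :
        ∑ i : Fin p, (g (Ms i.succ) - g (Ms i.castSucc)) = g (Ms (Fin.last p)) - g (Ms 0) := by
      rw [Finset.sum_sub_distrib, sub_eq_sub_iff_add_eq_add, add_comm,
        ← Fin.sum_univ_succ (fun i => g (Ms i)), Fin.sum_univ_castSucc, add_comm]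
    have hterm (i : Fin p) : w i x = s * (s * x) * (((Ms i.succ).card : ℝ) - (Ms i.castSucc).card)
        - s * (hermiteLogDeriv (Ms i.succ) (s * x) - hermiteLogDeriv (Ms i.castSucc) (s * x)) := by
      rw [hwx, ← hσ']
      ring
    simp only [hterm]
    rw [Finset.sum_sub_distrib, ← Finset.mul_sum, ← Finset.mul_sum, htel fun S => (S.card : ℝ),
      htel fun S => hermiteLogDeriv S (s * x), hcyc, hMs0, hermiteLogDeriv_shift,
      card_range_union_image_add]
    push_cast
    linear_combination k * x * hs2
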